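/- arXiv:2207.07398 — 8 statements merged into one kernel-verified Lean document; each statement's English description precedes it below -/
import Mathlib

section
/- For every q ∈ (0,∞) with q ≠ 1 and every r ∈ (0,4], the q-deformed logistic map Φ_{q,r} = φ_q ∘ f_r satisfies Φ_{q,r}(0) = Φ_{q,r}(1) = 0, is strictly increasing on [0,1/2] and strictly decreasing on [1/2,1]; that is, Φ_{q,r} is unimodal with unique turning point x₀ = 1/2. -/
open Real Set Filter

/-- The q-deformation φ_q(x) = (1 - q^x)/(1 - q). -/
noncomputable def phi (q x : ℝ) : ℝ := (1 - q ^ x) / (1 - q)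

/-- The logistic map f_r(x) = r·x·(1-x). -/
noncomputable def logistic (r x : ℝ) : ℝ := r * x * (1 - x)

/-- The q-deformed logistic map Φ_{q,r} = φ_q ∘ f_r. -/
noncomputable def Phi (q r x : ℝ) : ℝ := phi q (logistic r x)

theorem strictMono_phi {q : ℝ} (hq : 0 < q) (hq1 : q ≠ 1) : StrictMono (phi q) := by
  intro x y hxy
  rcases lt_or_gt_of_ne hq1 with h | h
  · exact div_lt_div_of_pos_right
      (sub_lt_sub_left (rpow_lt_rpow_of_exponent_gt hq h hxy) 1) (sub_pos.2 h)
  · exact div_lt_div_of_neg_of_lt (sub_neg.2 h)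
      (sub_lt_sub_left (rpow_lt_rpow_of_exponent_lt h hxy) 1)

theorem strictMonoOn_logistic {r : ℝ} (hr : 0 < r) :
    StrictMonoOn (logistic r) (Set.Icc 0 (1 / 2)) := by
  intro x hx y hy hxy
  have h : 0 < r * ((y - x) * (1 - x - y)) :=
    mul_pos hr (mul_pos (by linarith) (by linarith [hy.2]))
  unfold logistic
  linarith

theorem strictAntiOn_logistic {r : ℝ} (hr : 0 < r) :
    StrictAntiOn (logistic r) (Set.Icc (1 / 2) 1) := by
  intro x hx y hy hxy
  have h : 0 < r * ((y - x) * (x + y - 1)) :=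
    mul_pos hr (mul_pos (by linarith) (by linarith [hx.1]))
  unfold logistic
  linarith

/-- For every `q ∈ (0,∞)` with `q ≠ 1` and every `r ∈ (0,4]`, the map `Φ_{q,r}` satisfies
`Φ_{q,r}(0) = Φ_{q,r}(1) = 0`, is strictly increasing on `[0,1/2]` and strictly decreasing
on `[1/2,1]`; that is, it is unimodal with unique turning point `1/2`. -/
theorem stmt_1 (q r : ℝ) (hq : 0 < q) (hq1 : q ≠ 1) (hr : 0 < r) (hr4 : r ≤ 4) :
    Phi q r 0 = 0 ∧ Phi q r 1 = 0 ∧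
    StrictMonoOn (Phi q r) (Set.Icc 0 (1/2)) ∧
    StrictAntiOn (Phi q r) (Set.Icc (1/2) 1) := by
  exact ⟨by simp [Phi, phi, logistic], by simp [Phi, phi, logistic],
    (strictMono_phi hq hq1).comp_strictMonoOn (strictMonoOn_logistic hr),
    (strictMono_phi hq hq1).comp_strictAntiOn (strictAntiOn_logistic hr)⟩
end

section
/- For every q ∈ (0,∞) with q ≠ 1, every r ∈ (0,4], and every x ∈ [0,1] with x ≠ 1/2, the Schwarzian derivative of Φ_{q,r} = φ_q ∘ f_r at x equals −(r·(1 − 2x))²·(log q)²/2 − 6/(1 − 2x)², which is strictly negative. -/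
open Real Set Filter

/-- The Schwarzian derivative S(f)(x) = f'''(x)/f'(x) - (3/2)·(f''(x)/f'(x))². -/
noncomputable def schwarzian (f : ℝ → ℝ) (x : ℝ) : ℝ :=
  iteratedDeriv 3 f x / deriv f x - (3/2) * (iteratedDeriv 2 f x / deriv f x) ^ 2

lemma hasDerivAt_rpow_logistic {q : ℝ} (hq : 0 < q) (r x : ℝ) :
    HasDerivAt (fun y => q ^ logistic r y)
      (r * (1 - 2 * x) * Real.log q * q ^ logistic r x) x := by
  have h : HasDerivAt (logistic r) (r * (1 - 2 * x)) x := by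
    unfold logistic
    refine (((hasDerivAt_id' x).const_mul r).mul ((hasDerivAt_id' x).const_sub 1)).congr_deriv ?_
    ring
  exact (h.const_rpow hq).congr_deriv (by ring)

lemma hasDerivAt_mul_one_sub_two_mul (r x : ℝ) :
    HasDerivAt (fun y => r * (1 - 2 * y)) (-2 * r) x :=
  ((((hasDerivAt_id' x).const_mul 2).const_sub 1).const_mul r).congr_deriv (by ring)

lemma deriv_Phi {q : ℝ} (hq : 0 < q) (r : ℝ) :
    deriv (Phi q r) = fun x =>
      -(Real.log q / (1 - q)) * (r * (1 - 2 * x) * q ^ logistic r x) := by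
  funext x
  have h := ((hasDerivAt_rpow_logistic hq r x).const_sub 1).div_const (1 - q)
  exact (h.congr_deriv (by ring)).deriv

lemma iteratedDeriv_two_Phi {q : ℝ} (hq : 0 < q) (r : ℝ) :
    iteratedDeriv 2 (Phi q r) = fun x =>
      -(Real.log q / (1 - q)) *
        ((-2 * r + (r * (1 - 2 * x)) ^ 2 * Real.log q) * q ^ logistic r x) := by
  rw [iteratedDeriv_succ, iteratedDeriv_one, deriv_Phi hq]
  funext x
  have h := ((hasDerivAt_mul_one_sub_two_mul r x).mul
    (hasDerivAt_rpow_logistic hq r x)).const_mul (-(Real.log q / (1 - q)))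
  exact (h.congr_deriv (by ring)).deriv

lemma iteratedDeriv_three_Phi {q : ℝ} (hq : 0 < q) (r : ℝ) :
    iteratedDeriv 3 (Phi q r) = fun x =>
      -(Real.log q / (1 - q)) *
        (r * (1 - 2 * x) * Real.log q * (-6 * r + (r * (1 - 2 * x)) ^ 2 * Real.log q) *
          q ^ logistic r x) := by
  rw [iteratedDeriv_succ, iteratedDeriv_two_Phi hq]
  funext x
  have h := (((((hasDerivAt_mul_one_sub_two_mul r x).fun_pow 2).mul_const
    (Real.log q)).const_add (-2 * r)).mul
    (hasDerivAt_rpow_logistic hq r x)).const_mul (-(Real.log q / (1 - q)))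
  exact (h.congr_deriv (by push_cast; ring)).deriv

/-- The closed form of the Schwarzian derivative of `Phi q r` away from the critical point. -/
lemma schwarzian_Phi {q r x : ℝ} (hq : 0 < q) (hq1 : q ≠ 1) (hr : r ≠ 0) (hx : x ≠ 1 / 2) :
    schwarzian (Phi q r) x
      = -(r * (1 - 2 * x)) ^ 2 * (Real.log q) ^ 2 / 2 - 6 / (1 - 2 * x) ^ 2 := by
  rw [schwarzian, iteratedDeriv_three_Phi hq, iteratedDeriv_two_Phi hq, deriv_Phi hq]
  beta_reduce
  have hE : q ^ logistic r x ≠ 0 := (Real.rpow_pos_of_pos hq _).ne'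
  have hL : Real.log q ≠ 0 := Real.log_ne_zero_of_pos_of_ne_one hq hq1
  have hq' : 1 - q ≠ 0 := sub_ne_zero.mpr hq1.symm
  have hu : 1 - 2 * x ≠ 0 := fun h => hx (by linarith)
  generalize q ^ logistic r x = E at *
  generalize Real.log q = L at *
  generalize 1 - 2 * x = u at *
  generalize 1 - q = d at *
  field_simp
  ring

/-- For every `q ∈ (0,∞)` with `q ≠ 1`, `r ∈ (0,4]` and `x ∈ [0,1]`, `x ≠ 1/2`,
the Schwarzian derivative of `Φ_{q,r}` at `x` equals
`-(r(1-2x))²·(log q)²/2 - 6/(1-2x)²`, which is strictly negative. -/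
theorem stmt_4 (q r : ℝ) (hq : 0 < q) (hq1 : q ≠ 1) (hr : 0 < r) (hr4 : r ≤ 4)
    (x : ℝ) (hx : x ∈ Set.Icc (0 : ℝ) 1) (hx2 : x ≠ 1/2) :
    schwarzian (Phi q r) x
      = -(r * (1 - 2*x)) ^ 2 * (Real.log q) ^ 2 / 2 - 6 / (1 - 2*x) ^ 2 ∧
    schwarzian (Phi q r) x < 0 := by
  have h := schwarzian_Phi hq hq1 hr.ne' hx2
  refine ⟨h, h ▸ ?_⟩
  have hu : 1 - 2 * x ≠ 0 := fun h => hx2 (by linarith)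
  have h₁ : 0 < 6 / (1 - 2 * x) ^ 2 := by positivity
  have h₂ : 0 ≤ (r * (1 - 2 * x)) ^ 2 * (Real.log q) ^ 2 := by positivity
  linarith
end

section
/- For all parameters 0 < q₁ < q₂ < 1 < q₃ < q₄, every r ∈ (0,4], and every x ∈ (0,1) such that f_r(x) < 1, the following chain of strict inequalities holds: Φ_{q₁,r}(x) > Φ_{q₂,r}(x) > f_r(x) > Φ_{q₃,r}(x) > Φ_{q₄,r}(x). -/
open Real Set Filter

/-- For `s ∈ (0,1)`, the map `q ↦ φ_q(s)` is strictly decreasing on `(0,∞) \ {1}`. -/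
theorem phi_strictAntiOn {s : ℝ} (hs0 : 0 < s) (hs1 : s < 1) :
    StrictAntiOn (fun q => phi q s) (Set.Ioi 0 \ {1}) := by
  rintro p ⟨hp, hp1⟩ q ⟨hq, hq1⟩ hpq
  have h := (Real.strictConcaveOn_rpow hs0 hs1).secant_strict_mono (Set.mem_Ici.2 zero_le_one)
    (Set.Ioi_subset_Ici_self hp) (Set.Ioi_subset_Ici_self hq) hp1 hq1 hpq
  simp only [Real.one_rpow] at h
  simpa only [phi, ← neg_sub _ (1 : ℝ), neg_div_neg_eq] using h

/-- Bernoulli's inequality: `φ_q(s) > s` for `q < 1`. -/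
theorem lt_phi_of_lt_one {q s : ℝ} (hs0 : 0 < s) (hs1 : s < 1) (hq : 0 ≤ q) (hq1 : q < 1) :
    s < phi q s := by
  have h := rpow_one_add_lt_one_add_mul_self (s := q - 1) (by linarith) (by linarith) hs0 hs1
  rw [add_sub_cancel] at h
  rw [phi, lt_div_iff₀ (by linarith)]
  linarith

/-- Bernoulli's inequality: `φ_q(s) < s` for `q > 1`. -/
theorem phi_lt_of_one_lt {q s : ℝ} (hs0 : 0 < s) (hs1 : s < 1) (hq1 : 1 < q) :
    phi q s < s := by
  have h := rpow_one_add_lt_one_add_mul_self (s := q - 1) (by linarith) (by linarith) hs0 hs1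
  rw [add_sub_cancel] at h
  rw [phi, div_lt_iff_of_neg (by linarith)]
  linarith

/-- For `0 < q₁ < q₂ < 1 < q₃ < q₄`, `r ∈ (0,4]` and `x ∈ (0,1)` with `f_r(x) < 1`:
`Φ_{q₁,r}(x) > Φ_{q₂,r}(x) > f_r(x) > Φ_{q₃,r}(x) > Φ_{q₄,r}(x)`. -/
theorem stmt_6 (q₁ q₂ q₃ q₄ r : ℝ) (h0 : 0 < q₁) (h12 : q₁ < q₂) (h21 : q₂ < 1)
    (h13 : 1 < q₃) (h34 : q₃ < q₄) (hr : 0 < r) (hr4 : r ≤ 4)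
    (x : ℝ) (hx : x ∈ Set.Ioo (0 : ℝ) 1) (hfx : logistic r x < 1) :
    Phi q₁ r x > Phi q₂ r x ∧ Phi q₂ r x > logistic r x ∧
    logistic r x > Phi q₃ r x ∧ Phi q₃ r x > Phi q₄ r x := by
  have hf : 0 < logistic r x := mul_pos (mul_pos hr hx.1) (sub_pos.2 hx.2)
  have hanti := phi_strictAntiOn hf hfx
  exact ⟨hanti ⟨h0, h12.trans h21 |>.ne⟩ ⟨h0.trans h12, h21.ne⟩ h12,
    lt_phi_of_lt_one hf hfx (h0.trans h12).le h21,
    phi_lt_of_one_lt hf hfx h13,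
    hanti ⟨zero_lt_one.trans h13, h13.ne'⟩
      ⟨zero_lt_one.trans (h13.trans h34), (h13.trans h34).ne'⟩ h34⟩
end

section
/- Let q ∈ (0,∞) with q ≠ 1 and r ∈ (0,4]. If r·log(q)/(q − 1) < 1, then the fixed point 0 of Φ_{q,r} = φ_q ∘ f_r is locally asymptotically stable: for every ε > 0 there is δ > 0 such that every x ∈ [0,δ) satisfies Φ_{q,r}ⁿ(x) < ε for all n ∈ ℕ, and moreover there is δ > 0 such that for every x ∈ [0,δ) the iterates Φ_{q,r}ⁿ(x) converge to 0 as n → ∞. -/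
open Real Set Filter

/-- Near a fixed point at the origin with multiplier of modulus `< 1`, a map is contracted
geometrically towards the origin. -/
theorem HasDerivAt.exists_abs_iterate_le {g : ℝ → ℝ} {a : ℝ} (hg : HasDerivAt g a 0)
    (hg0 : g 0 = 0) (ha : |a| < 1) :
    ∃ k, 0 ≤ k ∧ k < 1 ∧ ∃ δ > 0, ∀ x, |x| < δ → ∀ n : ℕ, |g^[n] x| ≤ k ^ n * |x| := by
  obtain ⟨k, hak, hk1⟩ := exists_between ha
  have hk0 : 0 ≤ k := (abs_nonneg a).trans hak.le
  have hev := (hasDerivAt_iff_isLittleO.mp hg).def (sub_pos.mpr hak)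
  obtain ⟨δ, hδ, hball⟩ := Metric.eventually_nhds_iff.mp hev
  have hstep : ∀ y, |y| < δ → |g y| ≤ k * |y| := by
    intro y hy
    have h := hball (y := y) (by simpa [Real.dist_eq] using hy)
    simp only [hg0, sub_zero, smul_eq_mul, Real.norm_eq_abs] at h
    have htri : |g y| ≤ |g y - y * a| + |y * a| := by
      simpa using abs_add_le (g y - y * a) (y * a)
    rw [abs_mul] at htri
    linarith
  refine ⟨k, hk0, hk1, δ, hδ, fun x hx n => ?_⟩
  induction n with
  | zero => simp
  | succ n ih =>
    rw [Function.iterate_succ_apply']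
    have hlt : |g^[n] x| < δ :=
      (ih.trans (mul_le_of_le_one_left (abs_nonneg x) (pow_le_one₀ hk0 hk1.le))).trans_lt hx
    calc |g (g^[n] x)| ≤ k * |g^[n] x| := hstep _ hlt
      _ ≤ k * (k ^ n * |x|) := by gcongr
      _ = k ^ (n + 1) * |x| := by ring

theorem Phi_zero (q r : ℝ) : Phi q r 0 = 0 := by
  simp [Phi, phi, logistic]

theorem hasDerivAt_Phi_zero {q : ℝ} (r : ℝ) (hq : 0 < q) :
    HasDerivAt (Phi q r) (r * Real.log q / (q - 1)) 0 := by
  have hf : HasDerivAt (logistic r) r 0 := by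
    have h := ((hasDerivAt_id (0 : ℝ)).const_mul r).mul ((hasDerivAt_id (0 : ℝ)).const_sub 1)
    have hval : r * 1 * (1 - id 0) + r * id 0 * -1 = r := by simp
    rw [hval] at h
    exact h
  have h := ((hf.const_rpow hq).const_sub 1).div_const (1 - q)
  have hval : -(Real.log q * r * q ^ logistic r 0) / (1 - q) = r * Real.log q / (q - 1) := by
    rw [← neg_sub 1 q, div_neg, ← neg_div]
    simp [logistic, mul_comm]
  rw [hval] at h
  exact h

/-- The multiplier `r·log q/(q-1)` of the fixed point `0` is positive. -/
theorem multiplier_pos {q r : ℝ} (hq : 0 < q) (hq1 : q ≠ 1) (hr : 0 < r) :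
    0 < r * Real.log q / (q - 1) := by
  rcases hq1.lt_or_gt with h | h
  · exact div_pos_of_neg_of_neg (mul_neg_of_pos_of_neg hr (Real.log_neg hq h)) (by linarith)
  · exact div_pos (mul_pos hr (Real.log_pos h)) (by linarith)

/-- If `r·log q/(q-1) < 1`, the fixed point `0` of `Φ_{q,r}` is locally asymptotically
stable: for every `ε > 0` there is `δ > 0` such that every `x ∈ [0,δ)` satisfies
`Φ_{q,r}ⁿ(x) < ε` for all `n`, and there is `δ > 0` such that for every `x ∈ [0,δ)` the
iterates `Φ_{q,r}ⁿ(x)` converge to `0`. -/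
theorem stmt_8 (q r : ℝ) (hq : 0 < q) (hq1 : q ≠ 1) (hr : 0 < r) (hr4 : r ≤ 4)
    (hlas : r * Real.log q / (q - 1) < 1) :
    (∀ ε > 0, ∃ δ > 0, ∀ x : ℝ, 0 ≤ x → x < δ → ∀ n : ℕ, (Phi q r)^[n] x < ε) ∧
    (∃ δ > 0, ∀ x : ℝ, 0 ≤ x → x < δ →
      Filter.Tendsto (fun n : ℕ => (Phi q r)^[n] x) Filter.atTop (nhds 0)) := by
  have hmult : |r * Real.log q / (q - 1)| < 1 := by
    rwa [abs_of_pos (multiplier_pos hq hq1 hr)]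
  obtain ⟨k, hk0, hk1, δ, hδ, hit⟩ :=
    (hasDerivAt_Phi_zero r hq).exists_abs_iterate_le (Phi_zero q r) hmult
  constructor
  · intro ε hε
    refine ⟨min δ ε, lt_min hδ hε, fun x hx0 hx n => ?_⟩
    have hxabs : |x| = x := abs_of_nonneg hx0
    calc (Phi q r)^[n] x ≤ |(Phi q r)^[n] x| := le_abs_self _
      _ ≤ k ^ n * |x| := hit x (by rw [hxabs]; exact hx.trans_le (min_le_left _ _)) n
      _ ≤ |x| := mul_le_of_le_one_left (abs_nonneg x) (pow_le_one₀ hk0 hk1.le)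
      _ < ε := by rw [hxabs]; exact hx.trans_le (min_le_right _ _)
  · refine ⟨δ, hδ, fun x hx0 hx => ?_⟩
    have hlim : Tendsto (fun n : ℕ => k ^ n * |x|) atTop (nhds 0) := by
      simpa using (tendsto_pow_atTop_nhds_zero_of_lt_one hk0 hk1).mul_const |x|
    exact squeeze_zero_norm (hit x (by rwa [abs_of_nonneg hx0])) hlim
end

section
/- Let q ∈ (0,∞) with q ≠ 1 and r ∈ (0,4], and suppose the fixed point 0 of Φ_{q,r} = φ_q ∘ f_r is locally asymptotically stable. Then 0 is globally asymptotically stable (i.e., Φ_{q,r}ⁿ(x) → 0 for every x ∈ (0,1)) if and only if Φ_{q,r}(x) < x for every x ∈ (0,1). -/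
open Real Set Filter

/-- A fixed point `x₀` of `g : [0,1] → [0,1]` is locally asymptotically stable:
(i) for every `ε > 0` there is a neighborhood `V` of `x₀` in `[0,1]` with
`|gⁿ(x) - x₀| < ε` for all `x ∈ V` and all `n`; (ii) there is a neighborhood `V` of `x₀`
in `[0,1]` such that `gⁿ(x) → x₀` for all `x ∈ V`. -/
def LAS (g : ℝ → ℝ) (x₀ : ℝ) : Prop :=
  (∀ ε > 0, ∃ V ∈ nhdsWithin x₀ (Set.Icc (0:ℝ) 1),
    ∀ x ∈ V ∩ Set.Icc (0:ℝ) 1, ∀ n : ℕ, |g^[n] x - x₀| < ε) ∧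
  (∃ V ∈ nhdsWithin x₀ (Set.Icc (0:ℝ) 1),
    ∀ x ∈ V ∩ Set.Icc (0:ℝ) 1,
      Filter.Tendsto (fun n : ℕ => g^[n] x) Filter.atTop (nhds x₀))

lemma continuous_Phi {q : ℝ} (hq : 0 < q) (r : ℝ) : Continuous (Phi q r) := by
  have h : Continuous fun x : ℝ => q ^ (r * x * (1 - x)) :=
    (Real.continuous_const_rpow hq.ne').comp (by fun_prop)
  exact (continuous_const.sub h).div_const _

lemma Phi_one (q r : ℝ) : Phi q r 1 = 0 := by
  simp [Phi, phi, logistic]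

lemma Phi_pos {q r x : ℝ} (hq : 0 < q) (hq1 : q ≠ 1) (hr : 0 < r) (hx : x ∈ Ioo (0 : ℝ) 1) :
    0 < Phi q r x := by
  have hf : 0 < logistic r x := mul_pos (mul_pos hr hx.1) (sub_pos.2 hx.2)
  rcases lt_or_gt_of_ne hq1 with h | h
  · exact div_pos (sub_pos.2 (Real.rpow_lt_one hq.le h hf)) (sub_pos.2 h)
  · exact div_pos_of_neg_of_neg (sub_neg.2 (Real.one_lt_rpow h hf)) (sub_neg.2 h)

/-- A continuous self-map of `(0,1)` lying strictly below the diagonal has all its orbits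
in `(0,1)` converging to `0`. -/
lemma tendsto_iterate_zero_of_lt_self {g : ℝ → ℝ} (hg : Continuous g)
    (hpos : ∀ x ∈ Ioo (0 : ℝ) 1, 0 < g x) (hlt : ∀ x ∈ Ioo (0 : ℝ) 1, g x < x)
    {x : ℝ} (hx : x ∈ Ioo (0 : ℝ) 1) : Tendsto (fun n : ℕ => g^[n] x) atTop (nhds 0) := by
  have hmem : ∀ n : ℕ, g^[n] x ∈ Ioo (0 : ℝ) 1 := by
    intro n
    induction n with
    | zero => exact hx
    | succ n ih =>
      rw [Function.iterate_succ_apply']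
      exact ⟨hpos _ ih, (hlt _ ih).trans ih.2⟩
  have hanti : Antitone fun n : ℕ => g^[n] x := antitone_nat_of_succ_le fun n => by
    rw [Function.iterate_succ_apply']
    exact (hlt _ (hmem n)).le
  have hbdd : BddBelow (range fun n : ℕ => g^[n] x) :=
    ⟨0, by rintro _ ⟨n, rfl⟩; exact (hmem n).1.le⟩
  have hlim := tendsto_atTop_ciInf hanti hbdd
  set L := ⨅ n : ℕ, g^[n] x
  have hL0 : 0 ≤ L := le_ciInf fun n => (hmem n).1.le
  have hL1 : L < 1 := (ciInf_le hbdd 0).trans_lt hx.2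
  have hfix : g L = L := isFixedPt_of_tendsto_iterate hlim hg.continuousAt
  have hL : L = 0 := by
    by_contra hne
    exact (hlt L ⟨lt_of_le_of_ne hL0 (Ne.symm hne), hL1⟩).ne hfix
  rwa [hL] at hlim

/-- If `g` vanishes at `1` and all orbits from `(0,1)` converge to `0`, then `g` lies strictly
below the diagonal on `(0,1)`. -/
lemma lt_self_of_tendsto_iterate_zero {g : ℝ → ℝ} (hg : Continuous g) (hg1 : g 1 = 0)
    (h : ∀ x ∈ Ioo (0 : ℝ) 1, Tendsto (fun n : ℕ => g^[n] x) atTop (nhds 0))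
    {x : ℝ} (hx : x ∈ Ioo (0 : ℝ) 1) : g x < x := by
  by_contra! hle
  obtain ⟨c, hc, hgc⟩ : (0 : ℝ) ∈ (fun y => g y - y) '' Icc x 1 :=
    intermediate_value_Icc' hx.2.le (hg.sub continuous_id).continuousOn
      ⟨by simp [hg1], sub_nonneg.2 hle⟩
  have hfix : g c = c := sub_eq_zero.1 hgc
  have hc0 : 0 < c := hx.1.trans_le hc.1
  have hc1 : c ≠ 1 := by
    rintro rfl
    linarith
  have hlim := h c ⟨hc0, lt_of_le_of_ne hc.2 hc1⟩
  simp only [Function.iterate_fixed hfix] at hlim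
  exact hc0.ne' (tendsto_nhds_unique tendsto_const_nhds hlim)

/-- If the fixed point `0` of `Φ_{q,r}` is LAS, then it is GAS (all orbits from `(0,1)`
converge to `0`) if and only if `Φ_{q,r}(x) < x` for every `x ∈ (0,1)`. -/
theorem stmt_10 (q r : ℝ) (hq : 0 < q) (hq1 : q ≠ 1) (hr : 0 < r) (hr4 : r ≤ 4)
    (hlas : LAS (Phi q r) 0) :
    (∀ x ∈ Set.Ioo (0:ℝ) 1,
        Filter.Tendsto (fun n : ℕ => (Phi q r)^[n] x) Filter.atTop (nhds 0)) ↔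
      (∀ x ∈ Set.Ioo (0:ℝ) 1, Phi q r x < x) := by
  exact ⟨fun h _ hx => lt_self_of_tendsto_iterate_zero (continuous_Phi hq r) (Phi_one q r) h hx,
    fun h _ hx => tendsto_iterate_zero_of_lt_self (continuous_Phi hq r)
      (fun _ hy => Phi_pos hq hq1 hr hy) h hx⟩
end

section
/- Let q₁, q₂ ∈ (0,∞) with q₁ ≠ 1, q₂ ≠ 1 and q₁ ≠ q₂. Then φ_{q₁}(x) ≠ φ_{q₂}(x) for every x ∈ (0,1); that is, the graphs of two q-deformations with distinct parameters intersect only at the endpoints 0 and 1. -/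
open Real Set Filter

/-- For `x ∈ (0,1)`, the map `q ↦ φ_q(x)` is strictly decreasing on `(0,∞) \ {1}`. -/
theorem phi_lt_phi_of_lt {p q x : ℝ} (hp : 0 < p) (hp1 : p ≠ 1) (hq1 : q ≠ 1) (hpq : p < q)
    (hx : x ∈ Set.Ioo (0:ℝ) 1) : phi q x < phi p x := by
  have h := (Real.strictConcaveOn_rpow hx.1 hx.2).secant_strict_mono
    (Set.mem_Ici.2 zero_le_one) (Set.mem_Ici.2 hp.le) (Set.mem_Ici.2 (hp.trans hpq).le)
    hp1 hq1 hpq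
  have phi_eq (r : ℝ) : phi r x = (r ^ x - 1 ^ x) / (r - 1) := by
    rw [phi, Real.one_rpow, ← neg_div_neg_eq, neg_sub, neg_sub]
  rw [phi_eq, phi_eq]
  exact h

/-- For `q₁, q₂ ∈ (0,∞)` with `q₁ ≠ 1`, `q₂ ≠ 1`, `q₁ ≠ q₂`, the graphs of `φ_{q₁}` and
`φ_{q₂}` meet only at the endpoints: `φ_{q₁}(x) ≠ φ_{q₂}(x)` for every `x ∈ (0,1)`. -/
theorem stmt_12 (q₁ q₂ : ℝ) (h₁ : 0 < q₁) (h₂ : 0 < q₂) (h₁1 : q₁ ≠ 1) (h₂1 : q₂ ≠ 1)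
    (hne : q₁ ≠ q₂) (x : ℝ) (hx : x ∈ Set.Ioo (0:ℝ) 1) :
    phi q₁ x ≠ phi q₂ x := by
  rcases lt_or_gt_of_ne hne with h | h
  · exact (phi_lt_phi_of_lt h₁ h₁1 h₂1 h hx).ne'
  · exact (phi_lt_phi_of_lt h₂ h₂1 h₁1 h hx).ne
end

section
/- The function r₂ : (0,∞)\{1} → ℝ defined by r₂(q) = 4·log((1 + q)/2)/log(q) is strictly increasing (i.e., for 0 < q < q' with q ≠ 1 ≠ q' one has r₂(q) < r₂(q')), r₂(q) tends to 0 as q → 0⁺, and r₂(q) tends to 4 as q → +∞. -/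
open Real Set Filter

/-- The curve `r₂(q) = 4·log((1+q)/2)/log q` defined by `Φ_{q,r}(1/2) = 1/2`. -/
noncomputable def r₂ (q : ℝ) : ℝ := 4 * Real.log ((1 + q) / 2) / Real.log q

/-- In the logarithmic coordinate `t = log q`, the numerator of `r₂` is strictly convex. -/
theorem strictConvexOn_log_one_add_exp_div_two :
    StrictConvexOn ℝ univ fun t : ℝ => Real.log ((1 + Real.exp t) / 2) := by
  have hderiv (t : ℝ) : HasDerivAt (fun t : ℝ => Real.log ((1 + Real.exp t) / 2))
      (1 - (1 + Real.exp t)⁻¹) t := by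
    have hpos : 0 < 1 + Real.exp t := by positivity
    convert (((Real.hasDerivAt_exp t).const_add 1).div_const 2).log (by positivity) using 1
    field_simp
    ring
  refine StrictMono.strictConvexOn_univ_of_deriv
    (continuous_iff_continuousAt.2 fun t => (hderiv t).continuousAt) ?_
  rw [funext fun t => (hderiv t).deriv]
  intro s t hst
  dsimp only
  gcongr

theorem r₂_lt_r₂ {q q' : ℝ} (hq : 0 < q) (hqq' : q < q') (hq1 : q ≠ 1) (hq'1 : q' ≠ 1) :
    r₂ q < r₂ q' := by
  have hq' := hq.trans hqq'
  have h := strictConvexOn_log_one_add_exp_div_two.secant_strict_mono (mem_univ 0)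
    (mem_univ (Real.log q)) (mem_univ (Real.log q'))
    (Real.log_ne_zero_of_pos_of_ne_one hq hq1) (Real.log_ne_zero_of_pos_of_ne_one hq' hq'1)
    (Real.log_lt_log hq hqq')
  norm_num [Real.exp_log hq, Real.exp_log hq'] at h
  simp only [r₂, mul_div_assoc]
  linarith

theorem tendsto_r₂_nhdsGT_zero : Tendsto r₂ (nhdsWithin 0 (Ioi 0)) (nhds 0) := by
  have hnum : ContinuousAt (fun q : ℝ => 4 * Real.log ((1 + q) / 2)) 0 := by
    fun_prop (disch := norm_num)
  exact (hnum.tendsto.mono_left nhdsWithin_le_nhds).div_atBot Real.tendsto_log_nhdsGT_zero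

theorem r₂_eq_four_add {q : ℝ} (hq : 1 < q) :
    r₂ q = 4 + 4 * Real.log ((1 + q⁻¹) / 2) / Real.log q := by
  have hlog : Real.log q ≠ 0 := (Real.log_pos hq).ne'
  have hq0 : 0 < q := one_pos.trans hq
  have hfactor : (1 + q) / 2 = q * ((1 + q⁻¹) / 2) := by
    field_simp
    ring
  rw [r₂, hfactor, Real.log_mul hq0.ne' (by positivity)]
  field_simp

theorem tendsto_r₂_atTop : Tendsto r₂ atTop (nhds 4) := by
  have hnum : ContinuousAt (fun x : ℝ => 4 * Real.log ((1 + x) / 2)) 0 := by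
    fun_prop (disch := norm_num)
  have h := ((hnum.tendsto.comp tendsto_inv_atTop_zero).div_atTop
    Real.tendsto_log_atTop).const_add 4
  rw [add_zero] at h
  refine h.congr' ?_
  filter_upwards [eventually_gt_atTop 1] with q hq
  exact (r₂_eq_four_add hq).symm

/-- The function `r₂` is strictly increasing on `(0,∞)\{1}` (for `0 < q < q'` with
`q ≠ 1 ≠ q'` one has `r₂(q) < r₂(q')`), tends to `0` as `q → 0⁺`, and tends to `4` as
`q → +∞`. -/
theorem stmt_15 :
    (∀ q q' : ℝ, 0 < q → q < q' → q ≠ 1 → q' ≠ 1 → r₂ q < r₂ q') ∧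
    Filter.Tendsto r₂ (nhdsWithin 0 (Set.Ioi 0)) (nhds 0) ∧
    Filter.Tendsto r₂ Filter.atTop (nhds 4) :=
  ⟨fun _ _ hq hqq' hq1 hq'1 => r₂_lt_r₂ hq hqq' hq1 hq'1, tendsto_r₂_nhdsGT_zero,
    tendsto_r₂_atTop⟩
end

section
/- Let k ≥ 1, let q₁, …, q_k ∈ (0,∞) all be different from 1, and let r ∈ (0,4]. Then the second derivative at 1/2 of the map Φ_{q_k,…,q₁,r} = φ_{q_k} ∘ ⋯ ∘ φ_{q₁} ∘ f_r is nonzero; in fact, for every k, Φ''_{q_{k+1},q_k,…,q₁,r}(1/2) = −(q_{k+1}^{Φ_{q_k,…,q₁,r}(1/2)} · log(q_{k+1})/(1 − q_{k+1})) · Φ''_{q_k,…,q₁,r}(1/2). -/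
open Real Set Filter

/-- The generalized q-deformed logistic map
`Φ_{q_k,…,q₁,r} = φ_{q_k} ∘ ⋯ ∘ φ_{q₁} ∘ f_r`, where `qs = [q₁, …, q_k]`. -/
noncomputable def PhiGen (qs : List ℝ) (r x : ℝ) : ℝ :=
  qs.foldl (fun y q => phi q y) (logistic r x)

lemma PhiGen_append_singleton (qs : List ℝ) (q r : ℝ) :
    PhiGen (qs ++ [q]) r = fun x => phi q (PhiGen qs r x) := by
  funext x
  simp [PhiGen, List.foldl_append]

lemma PhiGen_nil (r : ℝ) : PhiGen [] r = fun x => r * x * (1 - x) := rfl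

lemma contDiff_phi_comp {F : ℝ → ℝ} (hF : ContDiff ℝ 2 F) {q : ℝ} (hq : 0 < q) :
    ContDiff ℝ 2 (fun x => phi q (F x)) := by
  simp only [phi, Real.rpow_def_of_pos hq]
  fun_prop

lemma deriv_phi_comp {F : ℝ → ℝ} (hF : Differentiable ℝ F) {q : ℝ} (hq : 0 < q) :
    deriv (fun x => phi q (F x)) =
      fun x => -(q ^ F x * Real.log q / (1 - q)) * deriv F x := by
  funext x
  have h := (((hF x).hasDerivAt.const_rpow hq).const_sub 1).div_const (1 - q)
  refine Eq.trans h.deriv ?_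
  ring

lemma iteratedDeriv_two_phi_comp {F : ℝ → ℝ} (hF : ContDiff ℝ 2 F) {q a : ℝ} (hq : 0 < q)
    (ha : deriv F a = 0) :
    iteratedDeriv 2 (fun x => phi q (F x)) a =
      -(q ^ F a * Real.log q / (1 - q)) * iteratedDeriv 2 F a := by
  have hd : Differentiable ℝ F := hF.differentiable (by norm_num)
  have hd' : Differentiable ℝ (deriv F) := by
    simpa using hF.differentiable_iteratedDeriv 1 (by norm_num)
  simp only [iteratedDeriv_succ, iteratedDeriv_zero, deriv_phi_comp hd hq]
  have h := ((((hd a).hasDerivAt.const_rpow hq).mul_const (Real.log q)).div_const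
    (1 - q)).neg.mul (hd' a).hasDerivAt
  refine Eq.trans h.deriv ?_
  simp [ha]

lemma iteratedDeriv_two_logistic (r x : ℝ) :
    iteratedDeriv 2 (fun x : ℝ => r * x * (1 - x)) x = -2 * r := by
  have h (y : ℝ) : HasDerivAt (fun x : ℝ => r * x * (1 - x)) (r - 2 * r * y) y := by
    have := ((hasDerivAt_id y).const_mul r).mul ((hasDerivAt_id y).const_sub 1)
    exact this.congr_deriv (by simp; ring)
  rw [iteratedDeriv_succ, iteratedDeriv_one, funext fun y => (h y).deriv]
  exact ((((hasDerivAt_id x).const_mul (2 * r)).const_sub r).congr_deriv (by ring)).deriv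

lemma deriv_logistic_half (r : ℝ) : deriv (fun x : ℝ => r * x * (1 - x)) (1 / 2) = 0 := by
  have := ((hasDerivAt_id (1 / 2 : ℝ)).const_mul r).mul
    ((hasDerivAt_id (1 / 2 : ℝ)).const_sub 1)
  refine Eq.trans this.deriv ?_
  simp
  ring

lemma PhiGen_contDiff_and_critical (r : ℝ) (hr : r ≠ 0) (qs : List ℝ)
    (hqs : ∀ q ∈ qs, 0 < q ∧ q ≠ 1) :
    ContDiff ℝ 2 (PhiGen qs r) ∧ deriv (PhiGen qs r) (1 / 2) = 0 ∧
      iteratedDeriv 2 (PhiGen qs r) (1 / 2) ≠ 0 := by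
  induction qs using List.reverseRecOn with
  | nil =>
    rw [PhiGen_nil]
    refine ⟨by fun_prop, deriv_logistic_half r, ?_⟩
    rw [iteratedDeriv_two_logistic]
    simpa using hr
  | append_singleton qs q ih =>
    obtain ⟨hc, hd, hn⟩ := ih fun p hp => hqs p (by simp [hp])
    obtain ⟨hq, hq1⟩ := hqs q (by simp)
    rw [PhiGen_append_singleton]
    refine ⟨contDiff_phi_comp hc hq, ?_, ?_⟩
    · simp only [deriv_phi_comp (hc.differentiable (by norm_num)) hq, hd, mul_zero]
    · rw [iteratedDeriv_two_phi_comp hc hq hd]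
      exact mul_ne_zero (neg_ne_zero.mpr (div_ne_zero (mul_ne_zero (Real.rpow_pos_of_pos hq _).ne'
        (Real.log_ne_zero_of_pos_of_ne_one hq hq1)) (sub_ne_zero.mpr hq1.symm))) hn

/-- For `k ≥ 1`, `q₁, …, q_k ∈ (0,∞)` all `≠ 1`, and `r ∈ (0,4]`, the second derivative
of `Φ_{q_k,…,q₁,r}` at `1/2` is nonzero; moreover for any further deformation `q'` one has
`Φ''_{q',q_k,…,q₁,r}(1/2) = -(q'^{Φ_{q_k,…,q₁,r}(1/2)}·log q'/(1-q'))·Φ''_{q_k,…,q₁,r}(1/2)`. -/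
theorem stmt_18 (qs : List ℝ) (hk : qs ≠ []) (hqs : ∀ q ∈ qs, 0 < q ∧ q ≠ 1)
    (r : ℝ) (hr : 0 < r) (hr4 : r ≤ 4) :
    iteratedDeriv 2 (PhiGen qs r) (1/2) ≠ 0 ∧
    ∀ q' : ℝ, 0 < q' → q' ≠ 1 →
      iteratedDeriv 2 (PhiGen (qs ++ [q']) r) (1/2)
        = -(q' ^ (PhiGen qs r (1/2)) * Real.log q' / (1 - q'))
            * iteratedDeriv 2 (PhiGen qs r) (1/2) := by
  obtain ⟨hc, hd, hn⟩ := PhiGen_contDiff_and_critical r hr.ne' qs hqs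
  refine ⟨hn, fun q hq _ => ?_⟩
  rw [PhiGen_append_singleton, iteratedDeriv_two_phi_comp hc hq hd]
end
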